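/- Let F : ℝ → ℝ be locally Lipschitz with F(0) = 0 and satisfying hypothesis (H)_1. Then F(t)/t² → 0 as t → 0, i.e., F(t) = o(t²) at the origin. -/

import Mathlib

open Filter Real

/-- The Clarke generalized directional derivative of `F : ℝ → ℝ` at `t` in direction `s`:
`F⁰(t;s) = limsup_{w → t, τ → 0⁺} (F(w + τs) − F(w))/τ`. -/
noncomputable def clarkeDeriv (F : ℝ → ℝ) (t s : ℝ) : ℝ :=
  Filter.limsup (fun p : ℝ × ℝ => (F (p.1 + p.2 * s) - F p.1) / p.2)
    ((nhds t) ×ˢ (nhdsWithin 0 (Set.Ioi 0)))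

/-- The Clarke subdifferential `∂F(t) = {ξ : ξ·s ≤ F⁰(t;s) for all s}`. -/
def clarkeSubdiff (F : ℝ → ℝ) (t : ℝ) : Set ℝ :=
  {ξ : ℝ | ∀ s : ℝ, ξ * s ≤ clarkeDeriv F t s}

open Topology in
/-- The difference quotients defining `clarkeDeriv` are bounded above near `(t, 0⁺)`. -/
lemma LocallyLipschitz.isBoundedUnder_clarke_quotient {F : ℝ → ℝ} (hF : LocallyLipschitz F)
    (t s : ℝ) :
    IsBoundedUnder (· ≤ ·) (𝓝 t ×ˢ 𝓝[>] (0 : ℝ))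
      (fun p : ℝ × ℝ => (F (p.1 + p.2 * s) - F p.1) / p.2) := by
  obtain ⟨K, U, hU, hK⟩ := hF t
  have hfst : Tendsto (fun p : ℝ × ℝ => p.1) (𝓝 t ×ˢ 𝓝[>] (0 : ℝ)) (𝓝 t) := tendsto_fst
  have hsnd : Tendsto (fun p : ℝ × ℝ => p.2) (𝓝 t ×ˢ 𝓝[>] (0 : ℝ)) (𝓝[>] 0) := tendsto_snd
  have hadd : Tendsto (fun p : ℝ × ℝ => p.1 + p.2 * s) (𝓝 t ×ˢ 𝓝[>] (0 : ℝ)) (𝓝 t) := by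
    simpa using hfst.add ((hsnd.mono_right nhdsWithin_le_nhds).mul_const s)
  refine isBoundedUnder_of_eventually_le (a := K * |s|) ?_
  filter_upwards [hfst hU, hadd hU, hsnd self_mem_nhdsWithin] with p h1 h2 h3
  have hp : 0 < p.2 := h3
  rw [div_le_iff₀ hp]
  have h := hK.dist_le_mul _ h2 _ h1
  rw [Real.dist_eq, Real.dist_eq, add_sub_cancel_left, abs_mul, abs_of_pos hp] at h
  linarith [le_abs_self (F (p.1 + p.2 * s) - F p.1)]

open Topology in
lemma mem_clarkeSubdiff_of_isLocalExtr {F : ℝ → ℝ} (hF : LocallyLipschitz F) {c z : ℝ}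
    (h : IsLocalExtr (fun x => F x - c * x) z) : c ∈ clarkeSubdiff F z := by
  intro s
  have hid : Tendsto (fun τ : ℝ => τ) (𝓝[>] 0) (𝓝 0) := nhdsWithin_le_nhds
  suffices ∃ w : ℝ → ℝ, Tendsto w (𝓝[>] 0) (𝓝 z) ∧
      ∀ᶠ τ in 𝓝[>] (0 : ℝ), c * s ≤ (F (w τ + τ * s) - F (w τ)) / τ by
    obtain ⟨w, hw, hle⟩ := this
    exact le_limsup_of_frequently_le ((hw.prodMk tendsto_id).frequently hle.frequently)
      (hF.isBoundedUnder_clarke_quotient z s)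
  rcases h with h | h
  · have hlim : Tendsto (fun τ : ℝ => z + τ * s) (𝓝[>] 0) (𝓝 z) := by
      simpa using (hid.mul_const s).const_add z
    refine ⟨fun _ => z, tendsto_const_nhds, ?_⟩
    filter_upwards [hlim.eventually h, self_mem_nhdsWithin] with τ hτ hpos
    rw [le_div_iff₀ hpos]
    linarith
  · have hlim : Tendsto (fun τ : ℝ => z - τ * s) (𝓝[>] 0) (𝓝 z) := by
      simpa using (hid.mul_const s).const_sub z
    refine ⟨fun τ => z - τ * s, hlim, ?_⟩
    filter_upwards [hlim.eventually h, self_mem_nhdsWithin] with τ hτ hpos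
    rw [le_div_iff₀ hpos, sub_add_cancel]
    linarith

/-- Lebourg's mean value theorem on the real line. -/
lemma exists_mem_clarkeSubdiff_slope {F : ℝ → ℝ} (hF : LocallyLipschitz F) {a b : ℝ}
    (hab : a < b) : ∃ z ∈ Set.Ioo a b, (F b - F a) / (b - a) ∈ clarkeSubdiff F z := by
  obtain ⟨z, hz, hext⟩ := exists_isLocalExtr_Ioo
    (f := fun x => F x - (F b - F a) / (b - a) * x) hab
    (hF.continuous.sub (continuous_const.mul continuous_id)).continuousOn
    (by have := (sub_pos.2 hab).ne'
        field_simp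
        ring)
  exact ⟨z, hz, mem_clarkeSubdiff_of_isLocalExtr hF hext⟩

theorem stmt_4 (F : ℝ → ℝ) (hF : LocallyLipschitz F) (hF0 : F 0 = 0)
    (H1 : ∀ ε > (0 : ℝ), ∃ δ > (0 : ℝ), ∀ t : ℝ, 0 < |t| → |t| < δ →
      ∀ ξ ∈ clarkeSubdiff F t, |ξ| ≤ ε * |t|) :
    Filter.Tendsto (fun t : ℝ => F t / t ^ 2) (nhdsWithin 0 {(0 : ℝ)}ᶜ) (nhds 0) := by
  rw [Metric.tendsto_nhdsWithin_nhds]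
  intro ε hε
  obtain ⟨δ, hδ, H⟩ := H1 (ε / 2) (half_pos hε)
  refine ⟨δ, hδ, fun {t} ht0 ht => ?_⟩
  have ht0 : t ≠ 0 := ht0
  rw [dist_zero_right, Real.norm_eq_abs] at ht ⊢
  obtain ⟨z, hz0, hzt, hz⟩ : ∃ z, 0 < |z| ∧ |z| < |t| ∧ F t / t ∈ clarkeSubdiff F z := by
    rcases ht0.lt_or_gt with h | h
    · obtain ⟨z, ⟨h1, h2⟩, hz⟩ := exists_mem_clarkeSubdiff_slope hF h
      refine ⟨z, abs_pos.2 h2.ne, ?_, by simpa [hF0, neg_div_neg_eq] using hz⟩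
      rw [abs_of_neg h2, abs_of_neg h]
      linarith
    · obtain ⟨z, ⟨h1, h2⟩, hz⟩ := exists_mem_clarkeSubdiff_slope hF h
      refine ⟨z, abs_pos.2 h1.ne', ?_, by simpa [hF0] using hz⟩
      rwa [abs_of_pos h1, abs_of_pos h]
  have hb := H z hz0 (hzt.trans ht) _ hz
  have htpos : 0 < |t| := abs_pos.2 ht0
  rw [pow_two, ← div_div, abs_div, div_lt_iff₀ htpos]
  nlinarith
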